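/- arXiv:1203.5972 — 7 statements merged into one kernel-verified Lean document; each statement's English description precedes it below -/
import Mathlib

section
/- Let n ≥ 1, let E be a 2n-dimensional real inner product space, and let J : E → E be a linear isometry which is skew-adjoint, i.e. ⟨Jx, y⟩ = −⟨x, Jy⟩ for all x, y ∈ E. Then for every unit vector ν ∈ E and every orthonormal basis (f_1, …, f_{2n−1}) of the orthogonal complement of ν in E, one has Σ_{i=1}^{2n−1} Σ_{j=1}^{2n−1} ⟨J f_i, f_j⟩² = 2(n − 1). -/
open scoped RealInnerProductSpace

/-- Parseval's identity for an orthonormal basis of the orthogonal complement of a unit vector. -/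
theorem OrthonormalBasis.sum_sq_inner_span_singleton_orthogonal
    {ι E : Type*} [Fintype ι] [NormedAddCommGroup E] [InnerProductSpace ℝ E]
    {ν : E} (hν : ‖ν‖ = 1) (f : OrthonormalBasis ι ℝ ((Submodule.span ℝ {ν})ᗮ)) (x : E) :
    ∑ j, ⟪x, (f j : E)⟫ ^ 2 = ‖x‖ ^ 2 - ⟪x, ν⟫ ^ 2 := by
  have hνν : ⟪ν, ν⟫ = 1 := by rw [real_inner_self_eq_norm_sq, hν, one_pow]
  have hmem : x - ⟪x, ν⟫ • ν ∈ (Submodule.span ℝ {ν})ᗮ := by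
    rw [Submodule.mem_orthogonal_singleton_iff_inner_left, inner_sub_left,
      real_inner_smul_left, hνν, mul_one, sub_self]
  have hinner (j : ι) :
      ⟪x, (f j : E)⟫ = ⟪(⟨x - ⟪x, ν⟫ • ν, hmem⟩ : (Submodule.span ℝ {ν})ᗮ), f j⟫ := by
    have hj : ⟪ν, (f j : E)⟫ = 0 :=
      Submodule.mem_orthogonal_singleton_iff_inner_right.mp (f j).2
    rw [Submodule.coe_inner, inner_sub_left, real_inner_smul_left, hj, mul_zero, sub_zero]
  have hparseval := f.sum_sq_norm_inner_left ⟨x - ⟪x, ν⟫ • ν, hmem⟩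
  simp only [Real.norm_eq_abs, sq_abs, ← hinner, Submodule.coe_norm] at hparseval
  rw [hparseval, norm_sub_sq_real, norm_smul, hν, real_inner_smul_right, mul_one,
    Real.norm_eq_abs, sq_abs]
  ring

/-- If `E` is a `2n`-dimensional real inner product space and `J : E → E` is a
skew-adjoint linear isometry, then for every unit vector `ν` and every
orthonormal basis `f` of the orthogonal complement of `ν`, one has
`Σᵢ Σⱼ ⟨J fᵢ, fⱼ⟩² = 2(n - 1)`. -/
theorem gram_norm_restricted_complex_structure
    (n : ℕ) (hn : 1 ≤ n) {E : Type*} [NormedAddCommGroup E]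
    [InnerProductSpace ℝ E] [FiniteDimensional ℝ E]
    (hdim : Module.finrank ℝ E = 2 * n)
    (J : E →ₗ[ℝ] E) (hJiso : ∀ x : E, ‖J x‖ = ‖x‖)
    (hJskew : ∀ x y : E, ⟪J x, y⟫ = -⟪x, J y⟫)
    (ν : E) (hν : ‖ν‖ = 1)
    (f : OrthonormalBasis (Fin (2 * n - 1)) ℝ ((Submodule.span ℝ {ν})ᗮ)) :
    ∑ i : Fin (2 * n - 1), ∑ j : Fin (2 * n - 1),
        (⟪J (f i : E), (f j : E)⟫) ^ 2 = 2 * ((n : ℝ) - 1) := by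
  have hJν : ⟪J ν, ν⟫ = 0 := by
    have h := hJskew ν ν
    rw [real_inner_comm (J ν) ν] at h
    linarith
  have hrow (i : Fin (2 * n - 1)) :
      ∑ j, ⟪J (f i : E), (f j : E)⟫ ^ 2 = 1 - ⟪J ν, (f i : E)⟫ ^ 2 := by
    have hi : ‖(f i : E)‖ = 1 := f.orthonormal.1 i
    rw [f.sum_sq_inner_span_singleton_orthogonal hν, hJiso, hi, hJskew,
      real_inner_comm (J ν) (f i : E), neg_sq, one_pow]
  simp_rw [hrow]
  rw [Finset.sum_sub_distrib, f.sum_sq_inner_span_singleton_orthogonal hν, hJiso, hν, hJν]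
  have hcast : ((2 * n - 1 : ℕ) : ℝ) = 2 * n - 1 := by
    rw [Nat.cast_sub (by omega)]
    push_cast
    rfl
  simp only [Finset.sum_const, Finset.card_univ, Fintype.card_fin, nsmul_eq_mul, hcast]
  ring
end

section
/- Let E be a finite-dimensional real inner product space and let L : E → E be a skew-adjoint linear map (⟨Lu, v⟩ = −⟨u, Lv⟩ for all u, v ∈ E). For every x ∈ E with Lx ≠ 0, the map ν_H : y ↦ −Ly/‖Ly‖, defined on the open set {y : Ly ≠ 0}, is differentiable at x and the trace of its Fréchet derivative Dν_H(x) : E → E equals 0. -/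
open scoped RealInnerProductSpace

/-- A skew-adjoint linear map takes every vector to an orthogonal one. -/
lemma inner_self_eq_zero_of_skewAdjoint {E : Type*} [NormedAddCommGroup E]
    [InnerProductSpace ℝ E] {L : E →ₗ[ℝ] E} (hL : ∀ u v : E, ⟪L u, v⟫ = -⟪u, L v⟫) (u : E) :
    ⟪u, L u⟫ = 0 := by
  have h := hL u u
  rw [real_inner_comm] at h
  linarith

/-- A skew-adjoint linear map has trace zero. -/
lemma trace_eq_zero_of_skewAdjoint {E : Type*} [NormedAddCommGroup E] [InnerProductSpace ℝ E]
    [FiniteDimensional ℝ E] {L : E →ₗ[ℝ] E} (hL : ∀ u v : E, ⟪L u, v⟫ = -⟪u, L v⟫) :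
    LinearMap.trace ℝ E L = 0 := by
  rw [LinearMap.trace_eq_sum_inner L (stdOrthonormalBasis ℝ E)]
  exact Finset.sum_eq_zero fun i _ => inner_self_eq_zero_of_skewAdjoint hL _

/-- The directional derivative of `y ↦ ‖f y‖` vanishes in every direction `v` for which
`f' v` is orthogonal to `f x`. -/
lemma HasFDerivAt.norm_apply_eq_zero {E F : Type*} [NormedAddCommGroup E] [NormedSpace ℝ E]
    [NormedAddCommGroup F] [InnerProductSpace ℝ F] {f : E → F} {f' : E →L[ℝ] F}
    {n' : E →L[ℝ] ℝ} {x v : E} (hf : HasFDerivAt f f' x)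
    (hn : HasFDerivAt (fun y => ‖f y‖) n' x) (hx : f x ≠ 0) (hv : ⟪f x, f' v⟫ = 0) :
    n' v = 0 := by
  have h := DFunLike.congr_fun ((hn.pow 2).unique hf.norm_sq) v
  simpa [hv, hx] using h

/-- For a skew-adjoint linear map `L` on a finite-dimensional real inner
product space and a point `x` with `Lx ≠ 0`, the map `ν_H : y ↦ -Ly/‖Ly‖` is
differentiable at `x` and the trace of its Fréchet derivative vanishes. -/
theorem trace_fderiv_unit_horizontal_normal_eq_zero
    {E : Type*} [NormedAddCommGroup E] [InnerProductSpace ℝ E]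
    [FiniteDimensional ℝ E]
    (L : E →ₗ[ℝ] E) (hL : ∀ u v : E, ⟪L u, v⟫ = -⟪u, L v⟫)
    (x : E) (hx : L x ≠ 0) :
    DifferentiableAt ℝ (fun y : E => -(‖L y‖⁻¹ • L y)) x ∧
      LinearMap.trace ℝ E
        ((fderiv ℝ (fun y : E => -(‖L y‖⁻¹ • L y)) x).toLinearMap) = 0 := by
  set M : E →L[ℝ] E := L.toContinuousLinearMap
  have hM : HasFDerivAt (fun y => L y) M x := M.hasFDerivAt
  obtain ⟨n', hn⟩ : DifferentiableAt ℝ (fun y => ‖L y‖) x := hM.differentiableAt.norm ℝ hx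
  have hn0 : n' (L x) = 0 :=
    hM.norm_apply_eq_zero hn hx (inner_self_eq_zero_of_skewAdjoint hL _)
  have hν := (((hasDerivAt_inv (norm_ne_zero_iff.mpr hx)).comp_hasFDerivAt x hn).smul hM).fun_neg
  refine ⟨hν.differentiableAt, ?_⟩
  refine (congrArg (fun T : E →L[ℝ] E => LinearMap.trace ℝ E T.toLinearMap) hν.fderiv).trans ?_
  simp [M, LinearMap.trace_smulRight, hn0, trace_eq_zero_of_skewAdjoint hL]
end

section
/- Let E be a finite-dimensional real inner product space and let L : E → E be a skew-adjoint linear map (⟨Lu, v⟩ = −⟨u, Lv⟩ for all u, v ∈ E). Fix x ∈ E with Lx ≠ 0, set ν := −Lx/‖Lx‖, and let ν_H : y ↦ −Ly/‖Ly‖. Then for all vectors w₁, w₂ ∈ E orthogonal to ν one has ⟨Dν_H(x) w₁, w₂⟩ = −⟨Dν_H(x) w₂, w₁⟩; that is, the bilinear form (w₁, w₂) ↦ ⟨Dν_H(x) w₁, w₂⟩ is skew-symmetric on the orthogonal complement of ν. -/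
open scoped RealInnerProductSpace

/-- Tested against vectors orthogonal to `f x`, the derivative of the normalization of `f` at `x`
is the rescaled derivative of `f`. -/
theorem inner_fderiv_inv_norm_smul_of_inner_eq_zero
    {E F : Type*} [NormedAddCommGroup E] [NormedSpace ℝ E]
    [NormedAddCommGroup F] [InnerProductSpace ℝ F]
    {f : E → F} {x : E} (hf : DifferentiableAt ℝ f x) (hx : f x ≠ 0)
    (w : E) {v : F} (hv : ⟪f x, v⟫ = 0) :
    ⟪fderiv ℝ (fun y => ‖f y‖⁻¹ • f y) x w, v⟫ = ‖f x‖⁻¹ * ⟪fderiv ℝ f x w, v⟫ := by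
  have hnorm : DifferentiableAt ℝ (fun y => ‖f y‖⁻¹) x :=
    (hf.norm ℝ hx).fun_inv (norm_ne_zero_iff.mpr hx)
  rw [fderiv_fun_smul hnorm hf]
  simp [inner_add_left, real_inner_smul_left, hv]

/-- For a skew-adjoint linear map `L` on a finite-dimensional real inner
product space, a point `x` with `Lx ≠ 0`, and `ν := -Lx/‖Lx‖`, the bilinear
form `(w₁, w₂) ↦ ⟨Dν_H(x) w₁, w₂⟩` (where `ν_H : y ↦ -Ly/‖Ly‖`) is
skew-symmetric on the orthogonal complement of `ν`. -/
theorem fderiv_unit_horizontal_normal_skew_on_complement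
    {E : Type*} [NormedAddCommGroup E] [InnerProductSpace ℝ E]
    [FiniteDimensional ℝ E]
    (L : E →ₗ[ℝ] E) (hL : ∀ u v : E, ⟪L u, v⟫ = -⟪u, L v⟫)
    (x : E) (hx : L x ≠ 0)
    (ν : E) (hνdef : ν = -(‖L x‖⁻¹ • L x))
    (w₁ w₂ : E) (h₁ : ⟪w₁, ν⟫ = 0) (h₂ : ⟪w₂, ν⟫ = 0) :
    ⟪fderiv ℝ (fun y : E => -(‖L y‖⁻¹ • L y)) x w₁, w₂⟫
      = -⟪fderiv ℝ (fun y : E => -(‖L y‖⁻¹ • L y)) x w₂, w₁⟫ := by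
  have hLd : HasFDerivAt L L.toContinuousLinearMap x := L.toContinuousLinearMap.hasFDerivAt
  have horth : ∀ w : E, ⟪w, ν⟫ = 0 → ⟪L x, w⟫ = 0 := fun w hw => by
    simpa [hνdef, real_inner_smul_right, hx, real_inner_comm] using hw
  have hderiv : ∀ w v : E, ⟪v, ν⟫ = 0 →
      ⟪fderiv ℝ (fun y : E => -(‖L y‖⁻¹ • L y)) x w, v⟫ = -(‖L x‖⁻¹ * ⟪L w, v⟫) :=
    fun w v hv => by
      rw [fderiv_fun_neg, neg_apply, inner_neg_left,
        inner_fderiv_inv_norm_smul_of_inner_eq_zero hLd.differentiableAt hx w (horth v hv),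
        hLd.fderiv, LinearMap.coe_toContinuousLinearMap']
  rw [hderiv w₁ w₂ h₂, hderiv w₂ w₁ h₁, hL w₁ w₂, real_inner_comm, mul_neg]
end

section
/- Let Ω be an open subset of the Euclidean space ℝ^m, let h : ℝ^m → ℝ be continuously differentiable, let q : Ω → ℝ be continuous, and suppose ψ : Ω → ℝ is twice continuously differentiable with ψ > 0 on Ω and Δψ(p) + ⟨∇h(p), ∇ψ(p)⟩ = q(p)·ψ(p) for every p ∈ Ω. Then for every continuously differentiable function φ : ℝ^m → ℝ with compact support contained in Ω, one has ∫_Ω (‖∇φ‖² + q·φ²)·e^{h} dλ ≥ 0, where λ is Lebesgue measure. -/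
open scoped RealInnerProductSpace

/-- The Euclidean Laplacian of `f : ℝ^m → ℝ` at `p`, as the sum of the pure
second derivatives along the standard basis directions. -/
noncomputable def eucLap {m : ℕ} (f : EuclideanSpace ℝ (Fin m) → ℝ)
    (p : EuclideanSpace ℝ (Fin m)) : ℝ :=
  ∑ i : Fin m,
    fderiv ℝ (fun y => fderiv ℝ f y (EuclideanSpace.single i 1)) p
      (EuclideanSpace.single i 1)

/-- A directional derivative of a compactly supported `C¹` function has vanishing integral. -/
theorem integral_fderiv_apply_eq_zero_of_hasCompactSupport {E : Type*} [NormedAddCommGroup E]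
    [NormedSpace ℝ E] [FiniteDimensional ℝ E] [MeasurableSpace E] [BorelSpace E]
    {μ : MeasureTheory.Measure E} [μ.IsAddHaarMeasure]
    {F : E → ℝ} (hF : ContDiff ℝ 1 F) (hc : HasCompactSupport F) (v : E) :
    ∫ x, fderiv ℝ F x v ∂μ = 0 := by
  have hi : MeasureTheory.Integrable (fun x => fderiv ℝ F x v) μ :=
    ((hF.continuous_fderiv one_ne_zero).clm_apply
      continuous_const).integrable_of_hasCompactSupport (hc.fderiv_apply ℝ v)
  have key := integral_mul_fderiv_eq_neg_fderiv_mul_of_integrable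
    (μ := μ) (f := fun _ : E => (1 : ℝ)) (g := F) (v := v)
    (by simp) (by simpa using hi)
    (by simpa using hF.continuous.integrable_of_hasCompactSupport hc)
    (by simp) (fun x _ => hF.differentiable one_ne_zero x)
  simpa using key

theorem contDiff_mul_of_tsupport_subset {E : Type*} [NormedAddCommGroup E] [NormedSpace ℝ E]
    {n : WithTop ℕ∞} {Ω : Set E} (hΩ : IsOpen Ω) {f g : E → ℝ} (hf : ContDiff ℝ n f)
    (hsub : tsupport f ⊆ Ω) (hg : ContDiffOn ℝ n g Ω) :
    ContDiff ℝ n (fun x => f x * g x) := by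
  rw [contDiff_iff_contDiffAt]
  intro x
  by_cases hx : x ∈ Ω
  · exact hf.contDiffAt.mul (hg.contDiffAt (hΩ.mem_nhds hx))
  · have h0 : (fun x => f x * g x) =ᶠ[nhds x] fun _ => 0 := by
      filter_upwards [notMem_tsupport_iff_eventuallyEq.mp fun h => hx (hsub h)] with y hy
      simp [hy]
    exact contDiffAt_const.congr_of_eventuallyEq h0

theorem gradient_apply_eq_fderiv_single {m : ℕ} (f : EuclideanSpace ℝ (Fin m) → ℝ)
    (p : EuclideanSpace ℝ (Fin m)) (i : Fin m) :
    gradient f p i = fderiv ℝ f p (EuclideanSpace.single i 1) := by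
  have := InnerProductSpace.toDual_symm_apply (𝕜 := ℝ) (x := EuclideanSpace.single i (1 : ℝ))
    (y := fderiv ℝ f p)
  rw [← this, EuclideanSpace.inner_single_right]
  simp [gradient]

/-- The `v`-derivative of `φ² e^h ψ⁻¹ ∂ᵥψ`, bounded by completing the square. -/
theorem fderiv_sq_mul_exp_mul_inv_mul_fderiv_le {E : Type*} [NormedAddCommGroup E]
    [NormedSpace ℝ E] {φ h ψ : E → ℝ} {p : E} (v : E) (hφ : DifferentiableAt ℝ φ p)
    (hh : DifferentiableAt ℝ h p) (hψ : DifferentiableAt ℝ ψ p)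
    (hψ' : DifferentiableAt ℝ (fun y => fderiv ℝ ψ y v) p) (hpos : ψ p ≠ 0) :
    fderiv ℝ (fun y => φ y ^ 2 * (Real.exp (h y) * ((ψ y)⁻¹ * fderiv ℝ ψ y v))) p v ≤
      Real.exp (h p) * (fderiv ℝ φ p v) ^ 2 + φ p ^ 2 * Real.exp (h p) * (ψ p)⁻¹ *
        (fderiv ℝ (fun y => fderiv ℝ ψ y v) p v + fderiv ℝ h p v * fderiv ℝ ψ p v) := by
  have hinv : HasFDerivAt (fun y => (ψ y)⁻¹) (-(ψ p ^ 2)⁻¹ • fderiv ℝ ψ p) p :=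
    (hasDerivAt_inv hpos).comp_hasFDerivAt p hψ.hasFDerivAt
  have hd := (hφ.hasFDerivAt.pow 2).mul
    (hh.hasFDerivAt.exp.mul (hinv.mul hψ'.hasFDerivAt))
  have he : fderiv ℝ (fun y => φ y ^ 2 * (Real.exp (h y) * ((ψ y)⁻¹ * fderiv ℝ ψ y v))) p v
      = _ := DFunLike.congr_fun hd.fderiv v
  rw [he]
  have hs := mul_nonneg (Real.exp_pos (h p)).le
    (sq_nonneg (fderiv ℝ φ p v - φ p * (ψ p)⁻¹ * fderiv ℝ ψ p v))
  simp only [add_apply, smul_apply, smul_eq_mul, ← inv_pow]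
  norm_num
  simp only [← inv_pow]
  linarith

/-- Weighted stability inequality (Euclidean model of Lemma 6.2): if a positive
`C²` function `ψ` on an open set `Ω ⊆ ℝ^m` satisfies the drift equation
`Δψ + ⟨∇h, ∇ψ⟩ = q·ψ`, then `∫_Ω (‖∇φ‖² + q φ²) e^h ≥ 0` for every `C¹`
function `φ` with compact support contained in `Ω`. -/
theorem weighted_stability_inequality
    (m : ℕ) (Ω : Set (EuclideanSpace ℝ (Fin m))) (hΩ : IsOpen Ω)
    (h : EuclideanSpace ℝ (Fin m) → ℝ) (hh : ContDiff ℝ 1 h)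
    (q ψ : EuclideanSpace ℝ (Fin m) → ℝ) (hq : ContinuousOn q Ω)
    (hψ : ContDiffOn ℝ 2 ψ Ω) (hpos : ∀ p ∈ Ω, 0 < ψ p)
    (heq : ∀ p ∈ Ω, eucLap ψ p + ⟪gradient h p, gradient ψ p⟫ = q p * ψ p) :
    ∀ φ : EuclideanSpace ℝ (Fin m) → ℝ, ContDiff ℝ 1 φ → HasCompactSupport φ →
      tsupport φ ⊆ Ω →
      0 ≤ ∫ p in Ω, (‖gradient φ p‖ ^ 2 + q p * (φ p) ^ 2) * Real.exp (h p) := by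
  intro φ hφ hc hsub
  by_cases hI : MeasureTheory.IntegrableOn
      (fun p => (‖gradient φ p‖ ^ 2 + q p * (φ p) ^ 2) * Real.exp (h p)) Ω
  swap
  · exact (MeasureTheory.integral_undef hI).ge
  let e : Fin m → EuclideanSpace ℝ (Fin m) := fun i => EuclideanSpace.single i 1
  let F : Fin m → EuclideanSpace ℝ (Fin m) → ℝ := fun i y =>
    φ y ^ 2 * (Real.exp (h y) * ((ψ y)⁻¹ * fderiv ℝ ψ y (e i)))
  have hψ' : ∀ i, ContDiffOn ℝ 1 (fun y => fderiv ℝ ψ y (e i)) Ω := fun i =>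
    (hψ.fderiv_of_isOpen hΩ (by norm_num)).clm_apply contDiffOn_const
  have hsupp : tsupport (fun y => φ y ^ 2) ⊆ tsupport φ :=
    closure_mono fun x hx => by simpa using hx
  have hF : ∀ i, ContDiff ℝ 1 (F i) := fun i =>
    contDiff_mul_of_tsupport_subset hΩ (hφ.pow 2) (hsupp.trans hsub)
      (hh.exp.contDiffOn.mul (((hψ.of_le (by norm_num)).inv
        fun x hx => (hpos x hx).ne').mul (hψ' i)))
  have htF : ∀ i, tsupport (F i) ⊆ tsupport φ := fun i =>
    (tsupport_mul_subset_left (f := fun y => φ y ^ 2)).trans hsupp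
  have hcF : ∀ i, HasCompactSupport (F i) := fun i =>
    hc.of_isClosed_subset (isClosed_tsupport _) (htF i)
  have hiF : ∀ i, MeasureTheory.Integrable (fun x => fderiv ℝ (F i) x (e i)) := fun i =>
    (((hF i).continuous_fderiv one_ne_zero).clm_apply
      continuous_const).integrable_of_hasCompactSupport ((hcF i).fderiv_apply ℝ (e i))
  have hzero : ∫ p in Ω, ∑ i, fderiv ℝ (F i) p (e i) = 0 := by
    rw [MeasureTheory.integral_finsetSum _ fun i _ => (hiF i).integrableOn]
    refine Finset.sum_eq_zero fun i _ => ?_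
    rw [MeasureTheory.setIntegral_eq_integral_of_forall_compl_eq_zero]
    · exact integral_fderiv_apply_eq_zero_of_hasCompactSupport (hF i) (hcF i) (e i)
    · intro x hx
      rw [fderiv_of_notMem_tsupport (𝕜 := ℝ) fun hx' => hx (hsub (htF i hx'))]
      rfl
  rw [← hzero]
  refine MeasureTheory.setIntegral_mono_on
    (MeasureTheory.integrable_finsetSum _ fun i _ => (hiF i).integrableOn) hI
    hΩ.measurableSet fun p hp => ?_
  have hne := (hpos p hp).ne'
  refine (Finset.sum_le_sum fun i _ => fderiv_sq_mul_exp_mul_inv_mul_fderiv_le (e i)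
    (hφ.differentiable one_ne_zero p) (hh.differentiable one_ne_zero p)
    ((hψ.contDiffAt (hΩ.mem_nhds hp)).differentiableAt two_ne_zero)
    (((hψ' i).contDiffAt (hΩ.mem_nhds hp)).differentiableAt one_ne_zero) hne).trans_eq ?_
  have hdrift : ∑ i, (fderiv ℝ (fun y => fderiv ℝ ψ y (e i)) p (e i) +
      fderiv ℝ h p (e i) * fderiv ℝ ψ p (e i)) = q p * ψ p := by
    rw [← heq p hp, Finset.sum_add_distrib, PiLp.inner_apply]
    simp [eucLap, e, gradient_apply_eq_fderiv_single, mul_comm]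
  have hnorm : ‖gradient φ p‖ ^ 2 = ∑ i, fderiv ℝ φ p (e i) ^ 2 := by
    simp [EuclideanSpace.norm_sq_eq, e, gradient_apply_eq_fderiv_single]
  rw [Finset.sum_add_distrib, ← Finset.mul_sum, ← Finset.mul_sum, hdrift, hnorm]
  field_simp
end

section
/- Let n ≥ 1. On ℝ^{2n+1} with coordinates (x_1,…,x_n,y_1,…,y_n,t), consider the vector fields X_i = ∂/∂x_i − (y_i/2)∂/∂t and Y_i = ∂/∂y_i + (x_i/2)∂/∂t. Define, on the open set {(x,y,t) : x + y ≠ 0}, the functions a_i(x,y,t) = −(x_i + y_i)/(√2·‖x+y‖) and b_i(x,y,t) = (x_i + y_i)/(√2·‖x+y‖), where ‖x+y‖ is the Euclidean norm of (x_1+y_1, …, x_n+y_n) ∈ ℝ^n. Then at every point p of this open set, Σ_{i=1}^n [ (X_i a_i)(p) + (Y_i b_i)(p) ] = 0. -/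
noncomputable section

/-- The component of the unit horizontal normal of the hyperbolic paraboloid
along `X_i`, as a function of `(x, y, t) ∈ ℝ^n × ℝ^n × ℝ`. -/
def nuX (n : ℕ) (i : Fin n)
    (p : EuclideanSpace ℝ (Fin n) × EuclideanSpace ℝ (Fin n) × ℝ) : ℝ :=
  -(p.1 i + p.2.1 i) / (Real.sqrt 2 * ‖p.1 + p.2.1‖)

/-- The component of the unit horizontal normal of the hyperbolic paraboloid
along `Y_i`, as a function of `(x, y, t) ∈ ℝ^n × ℝ^n × ℝ`. -/
def nuY (n : ℕ) (i : Fin n)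
    (p : EuclideanSpace ℝ (Fin n) × EuclideanSpace ℝ (Fin n) × ℝ) : ℝ :=
  (p.1 i + p.2.1 i) / (Real.sqrt 2 * ‖p.1 + p.2.1‖)

/-- The two components of the horizontal normal are opposite. -/
lemma nuX_eq_neg_nuY (n : ℕ) (i : Fin n) : nuX n i = -nuY n i := by
  funext p
  simp only [nuX, nuY, Pi.neg_apply, neg_div]

/-- The derivative of `nuY` depends on the direction only through the sum of its `x`- and
`y`-components. -/
lemma fderiv_nuY_apply (n : ℕ) (i : Fin n) (x y : EuclideanSpace ℝ (Fin n)) (t : ℝ)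
    (hxy : x + y ≠ 0) (v : EuclideanSpace ℝ (Fin n) × EuclideanSpace ℝ (Fin n) × ℝ) :
    fderiv ℝ (nuY n i) (x, y, t) v =
      fderiv ℝ (fun w : EuclideanSpace ℝ (Fin n) => w i / (√2 * ‖w‖)) (x + y) (v.1 + v.2.1) := by
  let L : EuclideanSpace ℝ (Fin n) × EuclideanSpace ℝ (Fin n) × ℝ →L[ℝ]
      EuclideanSpace ℝ (Fin n) :=
    .fst ℝ _ _ + (ContinuousLinearMap.fst ℝ _ _).comp (.snd ℝ _ _)
  have hd : DifferentiableAt ℝ (fun w : EuclideanSpace ℝ (Fin n) => w i / (√2 * ‖w‖))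
      (L (x, y, t)) := by
    have hnorm : DifferentiableAt ℝ (fun w : EuclideanSpace ℝ (Fin n) => ‖w‖) (x + y) :=
      differentiableAt_id.norm ℝ hxy
    have hcoord : DifferentiableAt ℝ (fun w : EuclideanSpace ℝ (Fin n) => w i) (x + y) :=
      (EuclideanSpace.proj (𝕜 := ℝ) i).differentiableAt
    have hne : √2 * ‖x + y‖ ≠ 0 := by simpa using hxy
    have hden : DifferentiableAt ℝ (fun w : EuclideanSpace ℝ (Fin n) => √2 * ‖w‖) (x + y) :=
      hnorm.const_mul _
    simp only [div_eq_mul_inv]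
    exact hcoord.fun_mul (hden.fun_inv hne)
  exact congrArg (· v) (hd.hasFDerivAt.comp (x, y, t) L.hasFDerivAt).fderiv

/-- H-minimality of the hyperbolic paraboloid in the Heisenberg group `ℍⁿ`:
with `X_i = ∂/∂x_i - (y_i/2)∂/∂t` and `Y_i = ∂/∂y_i + (x_i/2)∂/∂t`, at every
point where `x + y ≠ 0` one has `Σᵢ (X_i a_i + Y_i b_i) = 0` for the components
`a_i, b_i` of the unit horizontal normal. -/
theorem horizontal_divergence_hyperbolic_paraboloid_eq_zero
    (n : ℕ) (hn : 1 ≤ n) (x y : EuclideanSpace ℝ (Fin n)) (t : ℝ)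
    (hxy : x + y ≠ 0) :
    ∑ i : Fin n,
      (fderiv ℝ (nuX n i) (x, y, t) (EuclideanSpace.single i 1, 0, -(y i) / 2)
        + fderiv ℝ (nuY n i) (x, y, t) (0, EuclideanSpace.single i 1, (x i) / 2))
      = 0 := by
  refine Finset.sum_eq_zero fun i _ => ?_
  simp [nuX_eq_neg_nuY, fderiv_neg, fderiv_nuY_apply n i x y t hxy]

end
end

section
/- Let n ≥ 1. On the open set {(x,y) ∈ ℝ^n × ℝ^n : x + y ≠ 0}, define a_i(x,y) = −(x_i + y_i)/(√2·‖x+y‖) and b_i(x,y) = (x_i + y_i)/(√2·‖x+y‖), and let 𝒥(x,y) be the 2n×2n matrix of all first-order partial derivatives of the functions (a_1,…,a_n,b_1,…,b_n) with respect to the variables (x_1,…,x_n,y_1,…,y_n). Then the squared Frobenius norm of 𝒥(x,y) equals 2(n−1)/‖x+y‖², and the symmetric part (𝒥+𝒥ᵀ)/2 and the skew-symmetric part (𝒥−𝒥ᵀ)/2 each have squared Frobenius norm equal to (n−1)/‖x+y‖². -/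
open Matrix

noncomputable section

/-- Components `a_i` of the unit horizontal normal of the hyperbolic
paraboloid, as functions of `(x, y) ∈ ℝ^n × ℝ^n`. -/
def aF (n : ℕ) (i : Fin n)
    (p : EuclideanSpace ℝ (Fin n) × EuclideanSpace ℝ (Fin n)) : ℝ :=
  -(p.1 i + p.2 i) / (Real.sqrt 2 * ‖p.1 + p.2‖)

/-- Components `b_i` of the unit horizontal normal of the hyperbolic
paraboloid, as functions of `(x, y) ∈ ℝ^n × ℝ^n`. -/
def bF (n : ℕ) (i : Fin n)
    (p : EuclideanSpace ℝ (Fin n) × EuclideanSpace ℝ (Fin n)) : ℝ :=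
  (p.1 i + p.2 i) / (Real.sqrt 2 * ‖p.1 + p.2‖)

/-- The `2n` component functions `(a_1, …, a_n, b_1, …, b_n)`. -/
def comps (n : ℕ) :
    Fin n ⊕ Fin n → (EuclideanSpace ℝ (Fin n) × EuclideanSpace ℝ (Fin n) → ℝ) :=
  Sum.elim (aF n) (bF n)

/-- The `2n` coordinate directions `(x_1, …, x_n, y_1, …, y_n)`. -/
def vars (n : ℕ) :
    Fin n ⊕ Fin n → EuclideanSpace ℝ (Fin n) × EuclideanSpace ℝ (Fin n) :=
  Sum.elim (fun j => (EuclideanSpace.single j 1, 0))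
    (fun j => (0, EuclideanSpace.single j 1))

/-- The `2n × 2n` Jacobian matrix of `(a_1, …, a_n, b_1, …, b_n)` with respect
to `(x_1, …, x_n, y_1, …, y_n)`. -/
def Jac (n : ℕ) (p : EuclideanSpace ℝ (Fin n) × EuclideanSpace ℝ (Fin n)) :
    Matrix (Fin n ⊕ Fin n) (Fin n ⊕ Fin n) ℝ :=
  Matrix.of fun k j => fderiv ℝ (comps n k) p (vars n j)

/-- The derivative of `bF n i` is `(√2 ‖u‖)⁻¹` times the `i`-th coordinate of the orthogonal
projection onto the complement of `u = p.1 + p.2`, applied to `v.1 + v.2`. -/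
theorem fderiv_bF_apply {n : ℕ} (i : Fin n)
    {p : EuclideanSpace ℝ (Fin n) × EuclideanSpace ℝ (Fin n)} (hp : p.1 + p.2 ≠ 0)
    (v : EuclideanSpace ℝ (Fin n) × EuclideanSpace ℝ (Fin n)) :
    fderiv ℝ (bF n i) p v = (√2 * ‖p.1 + p.2‖)⁻¹ *
      ((v.1 + v.2) i - (p.1 + p.2) i * inner ℝ (p.1 + p.2) (v.1 + v.2) / ‖p.1 + p.2‖ ^ 2) := by
  have hr : ‖p.1 + p.2‖ ≠ 0 := norm_ne_zero_iff.mpr hp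
  have h2 : √(2 : ℝ) ≠ 0 := by positivity
  let L := ContinuousLinearMap.fst ℝ (EuclideanSpace ℝ (Fin n)) (EuclideanSpace ℝ (Fin n)) +
    ContinuousLinearMap.snd ℝ _ _
  have hsq : HasFDerivAt (fun q : EuclideanSpace ℝ (Fin n) × EuclideanSpace ℝ (Fin n) =>
      √(‖L q‖ ^ 2)) _ p := (L.hasFDerivAt.norm_sq).sqrt (pow_ne_zero 2 hr)
  have hnum : HasFDerivAt (fun q => (L q) i) ((EuclideanSpace.proj i).comp L) p :=
    ((EuclideanSpace.proj (𝕜 := ℝ) i).comp L).hasFDerivAt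
  have hne : √2 * √(‖L p‖ ^ 2) ≠ 0 := by simpa [L, Real.sqrt_sq (norm_nonneg _)] using hp
  have h := hnum.mul ((hasDerivAt_inv hne).comp_hasFDerivAt p (hsq.const_mul √2))
  have hb : bF n i = (fun q => (L q) i) * (Inv.inv ∘ fun q => √2 * √(‖L q‖ ^ 2)) := by
    funext q
    simp [bF, L, Real.sqrt_sq (norm_nonneg _), div_eq_mul_inv]
  rw [hb, h.fderiv]
  simp only [L, _root_.add_apply, ContinuousLinearMap.coe_fst', ContinuousLinearMap.coe_snd',
    Real.sqrt_sq (norm_nonneg _), _root_.smul_apply,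
    ContinuousLinearMap.comp_apply, smul_eq_mul, nsmul_eq_mul, innerSL_apply_apply,
    Function.comp_apply]
  have hproj (w : EuclideanSpace ℝ (Fin n)) : EuclideanSpace.proj (𝕜 := ℝ) i w = w i := rfl
  rw [hproj]
  push_cast
  field_simp
  ring

theorem trace_fromBlocks {m n R : Type*} [Fintype m] [Fintype n] [AddCommMonoid R]
    (A : Matrix m m R) (B : Matrix m n R) (C : Matrix n m R) (D : Matrix n n R) :
    (fromBlocks A B C D).trace = A.trace + D.trace := by
  simp [trace]

/-- The matrix of `(√2 ‖u‖)⁻¹` times the orthogonal projection onto the complement of `u`. -/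
def projBlock {n : ℕ} (u : EuclideanSpace ℝ (Fin n)) : Matrix (Fin n) (Fin n) ℝ :=
  (√2 * ‖u‖)⁻¹ • (1 - (‖u‖ ^ 2)⁻¹ • vecMulVec u u)

theorem projBlock_transpose {n : ℕ} (u : EuclideanSpace ℝ (Fin n)) :
    (projBlock u)ᵀ = projBlock u := by
  simp [projBlock, transpose_vecMulVec]

theorem trace_projBlock_mul_self {n : ℕ} {u : EuclideanSpace ℝ (Fin n)} (hu : u ≠ 0) :
    (projBlock u * projBlock u).trace = ((n : ℝ) - 1) / (2 * ‖u‖ ^ 2) := by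
  have hr : ‖u‖ ≠ 0 := norm_ne_zero_iff.mpr hu
  have hdot : (u : Fin n → ℝ) ⬝ᵥ u = ‖u‖ ^ 2 := by
    rw [EuclideanSpace.real_norm_sq_eq]
    simp only [dotProduct, sq]
  have h2 : √(2 : ℝ) ^ 2 = 2 := Real.sq_sqrt zero_le_two
  simp only [projBlock, smul_mul_smul_comm, mul_sub, sub_mul, one_mul, mul_one, trace_smul,
    trace_sub, trace_one, Fintype.card_fin, vecMulVec_mul_vecMulVec, trace_vecMulVec, hdot,
    smul_eq_mul, dotProduct_smul]
  field_simp
  rw [h2]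
  ring

theorem comps_inl {n : ℕ} (i : Fin n) : comps n (Sum.inl i) = -bF n i := by
  funext p
  simp only [comps, Sum.elim_inl, aF, bF, neg_div, Pi.neg_apply]

theorem Jac_eq_fromBlocks {n : ℕ} {x y : EuclideanSpace ℝ (Fin n)} (hxy : x + y ≠ 0) :
    Jac n (x, y) = fromBlocks (-projBlock (x + y)) (-projBlock (x + y))
      (projBlock (x + y)) (projBlock (x + y)) := by
  have key (i j : Fin n) (v : EuclideanSpace ℝ (Fin n) × EuclideanSpace ℝ (Fin n))
      (hv : v.1 + v.2 = EuclideanSpace.single j 1) :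
      fderiv ℝ (bF n i) (x, y) v = projBlock (x + y) i j := by
    rw [fderiv_bF_apply i (p := (x, y)) hxy, hv]
    simp [projBlock, vecMulVec_apply, one_apply, EuclideanSpace.inner_single_right]
    left
    ring
  have hinl (i : Fin n) : fderiv ℝ (comps n (Sum.inl i)) (x, y) = -fderiv ℝ (bF n i) (x, y) := by
    rw [comps_inl, fderiv_neg]
  have hinr (i : Fin n) : comps n (Sum.inr i) = bF n i := rfl
  ext (i | i) (j | j)
  · simpa [Jac, hinl] using key i j (vars n (Sum.inl j)) (by simp [vars])
  · simpa [Jac, hinl] using key i j (vars n (Sum.inr j)) (by simp [vars])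
  · simpa [Jac, hinr] using key i j (vars n (Sum.inl j)) (by simp [vars])
  · simpa [Jac, hinr] using key i j (vars n (Sum.inr j)) (by simp [vars])

/-- For the hyperbolic paraboloid in `ℍⁿ`, the squared Frobenius norm of the
Jacobian `𝒥` of the unit horizontal normal equals `2(n-1)/‖x+y‖²`, and its
symmetric and skew-symmetric parts each have squared Frobenius norm
`(n-1)/‖x+y‖²`. -/
theorem frobenius_norms_jacobian_hyperbolic_paraboloid
    (n : ℕ) (hn : 1 ≤ n) (x y : EuclideanSpace ℝ (Fin n)) (hxy : x + y ≠ 0) :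
    (Jac n (x, y) * (Jac n (x, y))ᵀ).trace = 2 * ((n : ℝ) - 1) / ‖x + y‖ ^ 2 ∧
    ((((2 : ℝ)⁻¹ • (Jac n (x, y) + (Jac n (x, y))ᵀ)) *
        (((2 : ℝ)⁻¹ • (Jac n (x, y) + (Jac n (x, y))ᵀ)))ᵀ).trace
      = ((n : ℝ) - 1) / ‖x + y‖ ^ 2) ∧
    ((((2 : ℝ)⁻¹ • (Jac n (x, y) - (Jac n (x, y))ᵀ)) *
        (((2 : ℝ)⁻¹ • (Jac n (x, y) - (Jac n (x, y))ᵀ)))ᵀ).trace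
      = ((n : ℝ) - 1) / ‖x + y‖ ^ 2) := by
  have hr : ‖x + y‖ ≠ 0 := norm_ne_zero_iff.mpr hxy
  have hT := trace_projBlock_mul_self hxy
  rw [Jac_eq_fromBlocks hxy]
  refine ⟨?_, ?_, ?_⟩ <;>
  · simp [sub_eq_add_neg, fromBlocks_transpose, fromBlocks_add, fromBlocks_neg, fromBlocks_smul,
      fromBlocks_multiply, trace_fromBlocks, projBlock_transpose, mul_add, add_mul, hT]
    field_simp
    ring

end
end

section
/- Let n ≥ 1. On the open set {(x,y) ∈ ℝ^n × ℝ^n : x + y ≠ 0}, let ϖ(x,y) = √2/‖x+y‖, let ν_H have components a_i = −(x_i+y_i)/(√2‖x+y‖) and b_i = (x_i+y_i)/(√2‖x+y‖), and let ν_H° have components c_i = −(x_i+y_i)/(√2‖x+y‖) in both the x_i and the y_i slots. Then at every point of this set, Σ_{i=1}^n [ c_i·(∂ϖ/∂x_i) + c_i·(∂ϖ/∂y_i) ] = 2/‖x+y‖²; that is, the directional derivative ∂ϖ/∂ν_H° equals 2/‖x+y‖². -/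
noncomputable section

/-- The normalized vertical component `ϖ = √2/‖x+y‖` of the normal of the
hyperbolic paraboloid, as a function of `(x, y) ∈ ℝ^n × ℝ^n`. -/
def varpi (n : ℕ)
    (p : EuclideanSpace ℝ (Fin n) × EuclideanSpace ℝ (Fin n)) : ℝ :=
  Real.sqrt 2 / ‖p.1 + p.2‖

/-- The common components `c_i` of `ν_H° = -C_H^{2n+1}ν_H` in both the `x_i`
and the `y_i` slots. -/
def cF (n : ℕ) (i : Fin n)
    (p : EuclideanSpace ℝ (Fin n) × EuclideanSpace ℝ (Fin n)) : ℝ :=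
  -(p.1 i + p.2 i) / (Real.sqrt 2 * ‖p.1 + p.2‖)

/-- The differential of `ϖ` away from `{x + y = 0}`. -/
theorem fderiv_varpi_apply (n : ℕ) (p v : EuclideanSpace ℝ (Fin n) × EuclideanSpace ℝ (Fin n))
    (hp : p.1 + p.2 ≠ 0) :
    fderiv ℝ (varpi n) p v = -(√2 * inner ℝ (p.1 + p.2) (v.1 + v.2)) / ‖p.1 + p.2‖ ^ 3 := by
  have hpos : 0 < ‖p.1 + p.2‖ := norm_pos_iff.mpr hp
  have hadd : HasFDerivAt
      (fun q : EuclideanSpace ℝ (Fin n) × EuclideanSpace ℝ (Fin n) => q.1 + q.2)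
      (ContinuousLinearMap.fst ℝ _ _ + ContinuousLinearMap.snd ℝ _ _) p :=
    hasFDerivAt_fst.add hasFDerivAt_snd
  have hnorm := hadd.norm_sq.sqrt (pow_pos hpos 2).ne'
  simp only [Real.sqrt_sq (norm_nonneg _)] at hnorm
  have hvarpi : HasFDerivAt (varpi n) _ p :=
    ((hasDerivAt_inv hpos.ne').comp_hasFDerivAt p hnorm).const_mul √2
  rw [hvarpi.fderiv]
  simp [inner_add_left, inner_add_right]
  field_simp
  ring

/-- For the hyperbolic paraboloid in `ℍⁿ`, the directional derivative of
`ϖ = √2/‖x+y‖` along `ν_H°` equals `2/‖x+y‖²`: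
`Σᵢ (c_i ∂ϖ/∂x_i + c_i ∂ϖ/∂y_i) = 2/‖x+y‖²`. -/
theorem deriv_varpi_along_nu_circ
    (n : ℕ) (hn : 1 ≤ n) (x y : EuclideanSpace ℝ (Fin n)) (hxy : x + y ≠ 0) :
    ∑ i : Fin n,
      (cF n i (x, y) * fderiv ℝ (varpi n) (x, y) (EuclideanSpace.single i 1, 0)
        + cF n i (x, y) * fderiv ℝ (varpi n) (x, y) (0, EuclideanSpace.single i 1))
      = 2 / ‖x + y‖ ^ 2 := by
  have hpos : 0 < ‖x + y‖ := norm_pos_iff.mpr hxy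
  have hterm (i : Fin n) :
      cF n i (x, y) * fderiv ℝ (varpi n) (x, y) (EuclideanSpace.single i 1, 0)
        + cF n i (x, y) * fderiv ℝ (varpi n) (x, y) (0, EuclideanSpace.single i 1)
      = 2 / ‖x + y‖ ^ 4 * (x + y) i ^ 2 := by
    rw [fderiv_varpi_apply n _ _ hxy, fderiv_varpi_apply n _ _ hxy]
    simp only [cF, add_zero, zero_add, EuclideanSpace.inner_single_right, PiLp.add_apply,
      conj_trivial, one_mul]
    field_simp
    ring
  rw [Finset.sum_congr rfl fun i _ => hterm i, ← Finset.mul_sum,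
    ← EuclideanSpace.real_norm_sq_eq]
  field_simp

end
end
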